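/- (Case 2.3 reduction) Let 1 ≤ i < c < a < j ≤ n and let r = rad(i,j). Suppose ecc(i,j,c) = r (v_c is a center of G(i,j)) and d_{G(i,j)}(c,a) = r (v_a, strictly between i and j, is a farthest vertex of v_c). Then for every k with 1 ≤ k ≤ n, d_{G(c,j)}(c,k) ≤ r; consequently ecc(c,j,c) ≤ r, so if additionally r = r*, then the pair (c,j) is an optimal solution and v_c is a center of G(c,j). -/

import Mathlib

/-- Path distance along `P` between vertices `a` and `b`. -/
noncomputable def dP {X : Type*} [MetricSpace X] (v : ℕ → X) (a b : ℕ) : ℝ :=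
  ∑ m ∈ Finset.Ico (min a b) (max a b), dist (v m) (v (m + 1))

/-- Shortest-path distance in the augmented graph `G(i,j)`. -/
noncomputable def dG {X : Type*} [MetricSpace X] (v : ℕ → X) (i j a b : ℕ) : ℝ :=
  min (dP v a b)
    (min (dP v a i + dist (v i) (v j) + dP v j b)
         (dP v a j + dist (v i) (v j) + dP v i b))

/-- Eccentricity of vertex `c` in `G(i,j)`: `max_{1 ≤ k ≤ n} dG(c,k)`. -/
noncomputable def ecc {X : Type*} [MetricSpace X] (v : ℕ → X) (n i j c : ℕ) : ℝ :=
  sSup ((fun k => dG v i j c k) '' Set.Icc 1 n)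

/-- Radius of `G(i,j)`: `min_{1 ≤ c ≤ n} ecc(i,j,c)`. -/
noncomputable def rad {X : Type*} [MetricSpace X] (v : ℕ → X) (n i j : ℕ) : ℝ :=
  sInf ((fun c => ecc v n i j c) '' Set.Icc 1 n)

/-- Optimal radius: `min_{1 ≤ i ≤ j ≤ n} rad(i,j)`. -/
noncomputable def rstar {X : Type*} [MetricSpace X] (v : ℕ → X) (n : ℕ) : ℝ :=
  sInf {x | ∃ i j : ℕ, 1 ≤ i ∧ i ≤ j ∧ j ≤ n ∧ x = rad v n i j}

theorem aux_dP_nonneg {X : Type*} [MetricSpace X] (v : ℕ → X) (a b : ℕ) : 0 ≤ dP v a b :=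
  Finset.sum_nonneg fun _ _ => dist_nonneg

theorem aux_dP_comm {X : Type*} [MetricSpace X] (v : ℕ → X) (a b : ℕ) : dP v a b = dP v b a := by
  unfold dP; rw [min_comm, max_comm]

theorem aux_dP_add {X : Type*} [MetricSpace X] (v : ℕ → X) {a b c : ℕ} (h : a ≤ b) (h' : b ≤ c) :
    dP v a c = dP v a b + dP v b c := by
  unfold dP
  rw [min_eq_left h, min_eq_left h', max_eq_right h, max_eq_right h', min_eq_left (h.trans h'),
    max_eq_right (h.trans h')]
  exact (Finset.sum_Ico_consecutive _ h h').symm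

theorem aux_dist_le {X : Type*} [MetricSpace X] (v : ℕ → X) {a b : ℕ} (h : a ≤ b) :
    dist (v a) (v b) ≤ dP v a b := by
  unfold dP
  rw [min_eq_left h, max_eq_right h]
  exact dist_le_Ico_sum_dist v h

theorem aux_dP_self {X : Type*} [MetricSpace X] (v : ℕ → X) (a : ℕ) : dP v a a = 0 := by
  simp [dP]

theorem aux_dG_nonneg {X : Type*} [MetricSpace X] (v : ℕ → X) (i j a b : ℕ) : 0 ≤ dG v i j a b := by
  have h := aux_dP_nonneg v
  have : 0 ≤ dist (v i) (v j) := dist_nonneg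
  unfold dG
  refine le_min (h _ _) (le_min ?_ ?_)
  · linarith [h a i, h j b]
  · linarith [h a j, h i b]

theorem aux_ecc_nonneg {X : Type*} [MetricSpace X] (v : ℕ → X) (n i j c : ℕ) : 0 ≤ ecc v n i j c := by
  apply Real.sSup_nonneg
  rintro _ ⟨k, _, rfl⟩
  exact aux_dG_nonneg _ _ _ _ _

theorem aux_rad_nonneg {X : Type*} [MetricSpace X] (v : ℕ → X) (n i j : ℕ) : 0 ≤ rad v n i j := by
  apply Real.sInf_nonneg
  rintro _ ⟨k, _, rfl⟩
  exact aux_ecc_nonneg _ _ _ _ _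

/-- Case 2.3 reduction: if a center `c ∈ (i,j)` of `G(i,j)` has a
farthest vertex `v_a` with `c < a < j`, then `(c,j)` is at least as good. -/
theorem stmt_12 {X : Type*} [MetricSpace X] (n : ℕ) (hn : 2 ≤ n) (v : ℕ → X)
    (hv : Set.InjOn v (Set.Icc 1 n))
    (i c a j : ℕ) (hi : 1 ≤ i) (hic : i < c) (hca : c < a) (haj : a < j) (hjn : j ≤ n)
    (r : ℝ) (hr : r = rad v n i j)
    (hcenter : ecc v n i j c = r)
    (hfar : dG v i j c a = r) :
    (∀ k : ℕ, 1 ≤ k → k ≤ n → dG v c j c k ≤ r) ∧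
    ecc v n c j c ≤ r ∧
    (r = rstar v n →
      rad v n c j = rstar v n ∧ ecc v n c j c = rad v n c j) := by
  have nn := aux_dP_nonneg v
  have hle : ∀ k, 1 ≤ k → k ≤ n → dG v i j c k ≤ r := by
    intro k h1 h2
    rw [← hcenter]
    exact le_csSup ((Set.finite_Icc 1 n).image _).bddAbove ⟨k, ⟨h1, h2⟩, rfl⟩
  have hL : 0 < dist (v i) (v j) := by
    rw [dist_pos]
    intro h
    have := hv (Set.mem_Icc.2 ⟨hi, by omega⟩) (Set.mem_Icc.2 ⟨by omega, hjn⟩) h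
    omega
  have htri : dist (v c) (v j) ≤ dP v c i + dist (v i) (v j) := by
    have h1 := dist_triangle (v c) (v i) (v j)
    have h2 := aux_dist_le v hic.le
    rw [dist_comm (v c) (v i)] at h1
    rw [aux_dP_comm v c i]
    linarith
  have hdj := aux_dist_le v (hca.trans haj).le
  have hself := aux_dP_self v c
  have key : dP v 1 c ≤ r := by
    have h1 := hle 1 le_rfl (by omega)
    have hr2 : r ≤ dP v c j := by
      rw [← hfar, aux_dP_add v hca.le haj.le]
      have := nn a j
      exact (min_le_left _ _).trans (by linarith)
    unfold dG at h1
    rcases min_le_iff.1 h1 with h | h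
    · rwa [aux_dP_comm]
    rcases min_le_iff.1 h with h | h
    · have e1 := aux_dP_add v (show 1 ≤ c by omega) (hca.trans haj).le
      rw [aux_dP_comm v j 1] at h
      linarith [nn c i, nn c j]
    · linarith [nn i 1]
  have main : ∀ k : ℕ, 1 ≤ k → k ≤ n → dG v c j c k ≤ r := by
    intro k h1 h2
    rcases lt_or_ge k c with hk | hk
    · refine (min_le_left _ _).trans ?_
      rw [aux_dP_comm]
      linarith [aux_dP_add v h1 hk.le, nn 1 k]
    · refine le_trans ?_ (hle k h1 h2)
      unfold dG
      refine le_min (min_le_left _ _) (le_min ?_ ?_)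
      · refine (min_le_right _ _).trans ((min_le_left _ _).trans ?_)
        linarith
      · rcases le_total k j with hkj | hkj
        · refine (min_le_left _ _).trans ?_
          linarith [aux_dP_add v hk hkj, nn k j, nn i k]
        · refine (min_le_left _ _).trans ?_
          linarith [aux_dP_add v (hca.trans haj).le hkj,
            aux_dP_add v (show i ≤ j by omega) hkj, nn i j]
  have hecc : ecc v n c j c ≤ r := by
    apply csSup_le (Set.Nonempty.image _ ⟨1, by simp; omega⟩)
    rintro _ ⟨k, ⟨h1, h2⟩, rfl⟩
    exact main k h1 h2
  refine ⟨main, hecc, fun hrs => ?_⟩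
  have hA : rad v n c j ≤ ecc v n c j c :=
    csInf_le ((Set.finite_Icc 1 n).image _).bddBelow ⟨c, ⟨by omega, by omega⟩, rfl⟩
  have hB : rstar v n ≤ rad v n c j := by
    refine csInf_le ⟨0, ?_⟩ ⟨c, j, by omega, by omega, hjn, rfl⟩
    rintro _ ⟨i', j', _, _, _, rfl⟩
    exact aux_rad_nonneg _ _ _ _
  constructor <;> linarith
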